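/- Let a := max(1, (10008/17)ζ², 1251ζ² + 221/640). For every u ∈ ℝ with |u| ≤ 50ζ√2 and all z = (z₁, z₂), x = (x₁, x₂) ∈ ℝ² with (z₁² + z₂²)/2 ≥ a and (x₁² + x₂²)/2 ≤ 1, one has ζz₁² − 10z₁⁴ + (z₁ + u)z₂ − (2ζz₁ + z₂)(z₁ − x₁) − (13/4)z₂² ≤ −(1/8)(z₁² + z₂²); i.e. the time derivative of V(z) = (z₁²+z₂²)/2 along the local observer with gain L = −(2ζ,1)ᵀ is at most −W(z) = −V(z)/4 in this region, so the planar system satisfies assumption (H4). -/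

import Mathlib

/-- Let `a := max(1, (10008/17)ζ², 1251ζ² + 221/640)` for `ζ > 0` with
`25001ζ² + 2ζ ≤ 4`.  For every `u` with `|u| ≤ 50ζ√2` and all `z, x ∈ ℝ²` with
`(z₁² + z₂²)/2 ≥ a` and `(x₁² + x₂²)/2 ≤ 1`, the time derivative of `V(z) = (z₁² + z₂²)/2`
along the local observer with gain `L = −(2ζ, 1)ᵀ`, namely
`ζz₁² − 10z₁⁴ + (z₁ + u)z₂ − (2ζz₁ + z₂)(z₁ − x₁) − (13/4)z₂²`, is at most
`−W(z) = −(z₁² + z₂²)/8`; i.e. the planar system satisfies assumption (H4). -/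
theorem stmt_19 (ζ : ℝ) (hζpos : 0 < ζ) (hζ : 25001 * ζ ^ 2 + 2 * ζ ≤ 4)
    (z₁ z₂ x₁ x₂ u : ℝ) (hu : |u| ≤ 50 * ζ * Real.sqrt 2)
    (hz : (z₁ ^ 2 + z₂ ^ 2) / 2 ≥
      max (max 1 ((10008 / 17) * ζ ^ 2)) (1251 * ζ ^ 2 + 221 / 640))
    (hx : (x₁ ^ 2 + x₂ ^ 2) / 2 ≤ 1) :
    ζ * z₁ ^ 2 - 10 * z₁ ^ 4 + (z₁ + u) * z₂ - (2 * ζ * z₁ + z₂) * (z₁ - x₁)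
        - (13 / 4) * z₂ ^ 2 ≤ -((1 / 8) * (z₁ ^ 2 + z₂ ^ 2)) := by
  have hz' : 1 ≤ (z₁ ^ 2 + z₂ ^ 2) / 2 :=
    (le_max_left _ _).trans ((le_max_left _ _).trans hz)
  have hζ2 : 2 * ζ ≤ 1 / 10 := by nlinarith
  have hx₁ : x₁ ^ 2 ≤ 2 := by nlinarith [sq_nonneg x₂]
  have hu2 : u ^ 2 ≤ 4 / 5 := by
    have h : u ^ 2 ≤ (50 * ζ * √2) ^ 2 := sq_le_sq' (abs_le.mp hu).1 (abs_le.mp hu).2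
    rw [mul_pow, Real.sq_sqrt (by norm_num)] at h
    nlinarith
  have hinput : (u + x₁) * z₂ ≤ z₂ ^ 2 + 7 / 5 := by
    nlinarith [sq_nonneg (u + x₁ - 2 * z₂), sq_nonneg (u - x₁)]
  have hcross : 2 * ζ * z₁ * x₁ ≤ ζ * z₁ ^ 2 + 2 * ζ := by
    nlinarith [mul_nonneg hζpos.le (sq_nonneg (z₁ - x₁)),
      mul_le_mul_of_nonneg_left hx₁ hζpos.le]
  nlinarith [sq_nonneg (z₁ ^ 2 - 9 / 80)]
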